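/- Let R be a TRS over a first-order language L, let (l, r) ∈ R be a rule such that r is not a normal form of →_R and such that (r, l) is itself a rewrite rule (r is not a variable and every variable of l occurs in r), and let R' = (R \ {(l, r)}) ∪ {(l, l), (r, l)}. Then →_R has UNC if and only if →_{R'} has UNC. Moreover, if (l, l) ∈ R and l is not a normal form of →_{R \ {(l, l)}}, then →_R has UNC if and only if →_{R \ {(l, l)}} has UNC. -/

import Mathlib

open FirstOrder Language

/-- `(l, r)` is a rewrite rule: `l` is not a variable and every variable
occurring in `r` also occurs in `l`. -/
def IsRule (L : Language) (p : L.Term ℕ × L.Term ℕ) : Prop :=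
  (∀ v : ℕ, p.1 ≠ Term.var v) ∧ p.2.varFinset ⊆ p.1.varFinset

/-- The one-step rewrite relation of a finite set `R` of rules:
root steps are instances of rules, and rewriting is closed under
rewriting one argument of a function application. -/
inductive Rew (L : Language) (R : Finset (L.Term ℕ × L.Term ℕ)) :
    L.Term ℕ → L.Term ℕ → Prop
  | root (l r : L.Term ℕ) (σ : ℕ → L.Term ℕ) :
      (l, r) ∈ R → Rew L R (l.subst σ) (r.subst σ)
  | congr {n : ℕ} (f : L.Functions n) (ts : Fin n → L.Term ℕ) (i : Fin n)
      (t' : L.Term ℕ) :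
      Rew L R (ts i) t' →
      Rew L R (Term.func f ts) (Term.func f (Function.update ts i t'))

/-- `t` is a normal form of `→_R`. -/
def NF {L : Language} (R : Finset (L.Term ℕ × L.Term ℕ)) (t : L.Term ℕ) : Prop :=
  ∀ u, ¬ Rew L R t u

/-- `→_R` has unique normal forms with respect to conversion. -/
def UNC {L : Language} (R : Finset (L.Term ℕ × L.Term ℕ)) : Prop :=
  ∀ s t : L.Term ℕ, Relation.EqvGen (Rew L R) s t → NF R s → NF R t → s = t

/-- The rewrite relation is closed under substitution. -/
theorem Rew.subst {L : Language} {R : Finset (L.Term ℕ × L.Term ℕ)} {s t : L.Term ℕ}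
    (h : Rew L R s t) (σ : ℕ → L.Term ℕ) : Rew L R (s.subst σ) (t.subst σ) := by
  induction h with
  | root l r τ hlr =>
    have subst_subst (u : L.Term ℕ) :
        (u.subst τ).subst σ = u.subst fun v => (τ v).subst σ := by
      induction u with
      | var => rfl
      | func f ts ih => simp only [Term.subst, ih]
    rw [subst_subst, subst_subst]
    exact .root l r _ hlr
  | congr f ts i t' _ ih =>
    have hupdate : (fun j => (Function.update ts i t' j).subst σ) =
        Function.update (fun j => (ts j).subst σ) i (t'.subst σ) :=
      funext fun j => Function.apply_update (fun _ u => Term.subst u σ) ts i t' j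
    simp only [Term.subst, hupdate]
    exact .congr f _ i _ ih

/-- Conversion is closed under replacing one argument of a function application. -/
theorem eqvGen_rew_func_update {L : Language} {R : Finset (L.Term ℕ × L.Term ℕ)}
    {n : ℕ} (f : L.Functions n) (ts : Fin n → L.Term ℕ) (i : Fin n) {s t : L.Term ℕ}
    (h : Relation.EqvGen (Rew L R) s t) :
    Relation.EqvGen (Rew L R) (Term.func f (Function.update ts i s))
      (Term.func f (Function.update ts i t)) := by
  induction h with
  | rel s t h =>
    simpa using Relation.EqvGen.rel _ _
      (Rew.congr f (Function.update ts i s) i t (by simpa using h))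
  | refl s => exact .refl _
  | symm _ _ _ ih => exact .symm _ _ ih
  | trans _ _ _ _ _ ih₁ ih₂ => exact .trans _ _ _ ih₁ ih₂

/-- If every rule instance of `S` is a conversion of `T`, then so is every conversion of `S`. -/
theorem eqvGen_rew_of_rules {L : Language} {S T : Finset (L.Term ℕ × L.Term ℕ)}
    (h : ∀ l r, (l, r) ∈ S → ∀ σ, Relation.EqvGen (Rew L T) (l.subst σ) (r.subst σ))
    {s t : L.Term ℕ} (hst : Relation.EqvGen (Rew L S) s t) :
    Relation.EqvGen (Rew L T) s t := by
  induction hst with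
  | rel s t hst =>
    induction hst with
    | root l r σ hlr => exact h l r hlr σ
    | congr f ts i t' _ ih => simpa using eqvGen_rew_func_update f ts i ih
  | refl s => exact .refl _
  | symm _ _ _ ih => exact .symm _ _ ih
  | trans _ _ _ _ _ ih₁ ih₂ => exact .trans _ _ _ ih₁ ih₂

/-- A left-hand side of a rule is not a normal form. -/
theorem not_nf_of_mem {L : Language} {R : Finset (L.Term ℕ × L.Term ℕ)} {l r : L.Term ℕ}
    (h : (l, r) ∈ R) : ¬ NF R l := by
  intro hl
  refine hl (r.subst Term.var) ?_
  have subst_var (u : L.Term ℕ) : u.subst Term.var = u := by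
    induction u with
    | var => rfl
    | func f ts ih => simp only [Term.subst, ih]
  simpa only [subst_var] using Rew.root l r Term.var h

/-- If no left-hand side of `S` is a normal form of `T`, then normal forms of `T` are
normal forms of `S`. -/
theorem NF.of_rules {L : Language} {S T : Finset (L.Term ℕ × L.Term ℕ)}
    (h : ∀ l r, (l, r) ∈ S → ¬ NF T l) {t : L.Term ℕ} (ht : NF T t) : NF S t := by
  intro u hu
  induction hu with
  | root l r σ hlr => exact h l r hlr fun v hv => ht _ (hv.subst σ)
  | congr f ts i t' _ ih => exact ih fun v hv => ht _ (.congr f ts i v hv)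

/-- UNC transfers from `S` to `T` if rules of `S` are reducible in `T` and rules of `T` are
conversions of `S`. -/
theorem UNC.of_rules {L : Language} {S T : Finset (L.Term ℕ × L.Term ℕ)} (hS : UNC S)
    (hnf : ∀ l r, (l, r) ∈ S → ¬ NF T l)
    (hconv : ∀ l r, (l, r) ∈ T → ∀ σ, Relation.EqvGen (Rew L S) (l.subst σ) (r.subst σ)) :
    UNC T :=
  fun s t hst hs ht => hS s t (eqvGen_rew_of_rules hconv hst) (hs.of_rules hnf) (ht.of_rules hnf)

theorem unc_iff_rule_reversing_trs {L : Language} [DecidableEq (L.Term ℕ)]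
    (R : Finset (L.Term ℕ × L.Term ℕ)) (hR : ∀ p ∈ R, IsRule L p) :
    (∀ l r : L.Term ℕ, (l, r) ∈ R → ¬ NF R r → IsRule L (r, l) →
      (UNC R ↔ UNC (R.erase (l, r) ∪ {(l, l), (r, l)}))) ∧
    (∀ l : L.Term ℕ, (l, l) ∈ R → ¬ NF (R.erase (l, l)) l →
      (UNC R ↔ UNC (R.erase (l, l)))) := by
  refine ⟨fun l r hlr hr _ => ⟨fun h => ?_, fun h => ?_⟩,
    fun l _ hl => ⟨fun h => ?_, fun h => ?_⟩⟩
  · refine h.of_rules (fun a b hab => ?_) (fun a b hab σ => ?_)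
    · by_cases heq : (a, b) = (l, r)
      · obtain ⟨rfl, rfl⟩ := Prod.mk.inj heq
        exact not_nf_of_mem (r := a) (by simp)
      · exact not_nf_of_mem (r := b) (Finset.mem_union_left _ (Finset.mem_erase.2 ⟨heq, hab⟩))
    · rcases Finset.mem_union.1 hab with hab | hab
      · exact .rel _ _ (.root _ _ _ (Finset.mem_of_mem_erase hab))
      · simp only [Finset.mem_insert, Finset.mem_singleton, Prod.mk.injEq] at hab
        rcases hab with ⟨rfl, rfl⟩ | ⟨rfl, rfl⟩
        · exact .refl _
        · exact .symm _ _ (.rel _ _ (.root _ _ _ hlr))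
  · refine h.of_rules (fun a b hab => ?_) (fun a b hab σ => ?_)
    · rcases Finset.mem_union.1 hab with hab | hab
      · exact not_nf_of_mem (Finset.mem_of_mem_erase hab)
      · simp only [Finset.mem_insert, Finset.mem_singleton, Prod.mk.injEq] at hab
        rcases hab with ⟨rfl, rfl⟩ | ⟨rfl, rfl⟩
        · exact not_nf_of_mem hlr
        · exact hr
    · by_cases heq : (a, b) = (l, r)
      · obtain ⟨rfl, rfl⟩ := Prod.mk.inj heq
        exact .symm _ _ (.rel _ _ (.root _ _ _ (by simp)))
      · exact .rel _ _ (.root _ _ _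
          (Finset.mem_union_left _ (Finset.mem_erase.2 ⟨heq, hab⟩)))
  · refine h.of_rules (fun a b hab => ?_) (fun a b hab σ => ?_)
    · by_cases heq : (a, b) = (l, l)
      · obtain ⟨rfl, rfl⟩ := Prod.mk.inj heq
        exact hl
      · exact not_nf_of_mem (Finset.mem_erase.2 ⟨heq, hab⟩)
    · exact .rel _ _ (.root _ _ _ (Finset.mem_of_mem_erase hab))
  · refine h.of_rules (fun a b hab => not_nf_of_mem (Finset.mem_of_mem_erase hab))
      (fun a b hab σ => ?_)
    by_cases heq : (a, b) = (l, l)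
    · obtain ⟨rfl, rfl⟩ := Prod.mk.inj heq
      exact .refl _
    · exact .rel _ _ (.root _ _ _ (Finset.mem_erase.2 ⟨heq, hab⟩))
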